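/- Let (M,[·,·]) be a Malcev superalgebra over a field K of characteristic 0. Define a trilinear operation on M by {x,y,z} := (1/3)(2[[x,y],z] − (−1)^{|x|(|y|+|z|)}[[y,z],x] − (−1)^{|z|(|x|+|y|)}[[z,x],y]) for homogeneous x,y,z. Then (M, [·,·], {·,·,·}) is a Bol superalgebra, i.e. it satisfies axioms (BS1)–(BS5) with the binary product [·,·] and ternary bracket {·,·,·}. -/

import Mathlib

open LinearMap

/-- The sign `(-1)^(i·j)` in the ground field, for parities `i j : ZMod 2`. -/
def sgn (K : Type*) [Field K] (i j : ZMod 2) : K := (-1 : K) ^ (i * j).val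

/-- A Bol superalgebra over `K`: a `ZMod 2`-graded vector space with a bilinear
product `mul` and a trilinear bracket `tri` satisfying (BS1)–(BS5) on
homogeneous elements. -/
structure BolSuper (K : Type*) (B : Type*) [Field K] [AddCommGroup B] [Module K B] where
  g : ZMod 2 → Submodule K B
  internal : DirectSum.IsInternal g
  mul : B →ₗ[K] B →ₗ[K] B
  tri : B →ₗ[K] B →ₗ[K] B →ₗ[K] B
  mul_mem : ∀ i j x y, x ∈ g i → y ∈ g j → mul x y ∈ g (i + j)
  tri_mem : ∀ i j k x y z, x ∈ g i → y ∈ g j → z ∈ g k → tri x y z ∈ g (i + j + k)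
  bs1 : ∀ i j x y, x ∈ g i → y ∈ g j → mul x y = -(sgn K i j • mul y x)
  bs2 : ∀ i j k x y z, x ∈ g i → y ∈ g j → z ∈ g k → tri x y z = -(sgn K i j • tri y x z)
  bs3 : ∀ i j k x y z, x ∈ g i → y ∈ g j → z ∈ g k →
    tri x y z + sgn K i (j + k) • tri y z x + sgn K k (i + j) • tri z x y = 0
  bs4 : ∀ i j k l m x y u v w, x ∈ g i → y ∈ g j → u ∈ g k → v ∈ g l → w ∈ g m →
    tri x y (tri u v w) = tri (tri x y u) v w + sgn K k (i + j) • tri u (tri x y v) w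
      + sgn K (i + j) (k + l) • tri u v (tri x y w)
  bs5 : ∀ i j k l x y u v, x ∈ g i → y ∈ g j → u ∈ g k → v ∈ g l →
    tri x y (mul u v) = sgn K k (i + j) • mul u (tri x y v) + mul (tri x y u) v
      + sgn K (i + j) (k + l) • tri u v (mul x y) + mul (mul x y) (mul u v)

variable {K B L : Type*} [Field K] [AddCommGroup B] [Module K B]

/-- `P` is a pseudo superderivation of degree `r` of the Bol superalgebra `A`
with companion `a ∈ A.g r`. -/
def IsPSD (A : BolSuper K B) (r : ZMod 2) (P : B →ₗ[K] B) (a : B) : Prop :=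
  a ∈ A.g r ∧
  (∀ i x, x ∈ A.g i → P x ∈ A.g (i + r)) ∧
  (∀ i j k x y z, x ∈ A.g i → y ∈ A.g j → z ∈ A.g k →
    P (A.tri x y z) = A.tri (P x) y z + sgn K r i • A.tri x (P y) z
      + sgn K r (i + j) • A.tri x y (P z)) ∧
  (∀ i j x y, x ∈ A.g i → y ∈ A.g j →
    P (A.mul x y) = sgn K r i • A.mul x (P y) + A.mul (P x) y
      + sgn K r (i + j) • A.tri x y a + A.mul a (A.mul x y))

/-- The bracket on pairs (pseudo superderivation, companion), for degrees `r`, `s`. -/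
def pbrk (A : BolSuper K B) (r s : ZMod 2)
    (pa qb : (B →ₗ[K] B) × B) : (B →ₗ[K] B) × B :=
  (pa.1 ∘ₗ qb.1 - sgn K r s • (qb.1 ∘ₗ pa.1),
   pa.1 qb.2 - sgn K r s • qb.1 pa.2 - A.mul pa.2 qb.2)

/-- The bracket on `B ⊕ H` (elements encoded as pairs `(x, (P, a))`),
for degrees `r`, `s`. -/
def lbrk (A : BolSuper K B) (r s : ZMod 2)
    (u v : B × ((B →ₗ[K] B) × B)) : B × ((B →ₗ[K] B) × B) :=
  (u.2.1 v.1 - sgn K r s • v.2.1 u.1,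
   (A.tri u.1 v.1 + (pbrk A r s u.2 v.2).1,
    A.mul u.1 v.1 + (pbrk A r s u.2 v.2).2))

/-- The degree-`r` part of the span of the inner pairs `(D_{x,u}, x·u)` with
`x` homogeneous in `B` and `u` homogeneous in the graded subspace `S`. -/
def IPSpan (A : BolSuper K B) (S : ZMod 2 → Submodule K B) (r : ZMod 2) :
    Submodule K ((B →ₗ[K] B) × B) :=
  Submodule.span K {pa | ∃ i j x u, i + j = r ∧ x ∈ A.g i ∧ u ∈ S j ∧
    pa = (A.tri x u, A.mul x u)}

/-- Data presenting a Lie superalgebra `L` as the standard enveloping Lie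
superalgebra `L(B) = B ⊕ IPS(B,B)` of the Bol superalgebra `A`, together with
the grading involution `sigma` used to define supertraces. -/
structure EnvSetup (K B L : Type*) [Field K] [AddCommGroup B] [Module K B]
    [AddCommGroup L] [Module K L] (A : BolSuper K B) where
  brk : L →ₗ[K] L →ₗ[K] L
  iota : B →ₗ[K] L
  jmap : ((B →ₗ[K] B) × B) →ₗ[K] L
  gL : ZMod 2 → Submodule K L
  gL_eq : ∀ r, gL r = (A.g r).map iota ⊔ (IPSpan A A.g r).map jmap
  surj : ∀ v : L, ∃ x pa, pa ∈ IPSpan A A.g 0 ⊔ IPSpan A A.g 1 ∧ v = iota x + jmap pa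
  inj : ∀ x pa, pa ∈ IPSpan A A.g 0 ⊔ IPSpan A A.g 1 → iota x + jmap pa = 0 →
    x = 0 ∧ pa = 0
  brk_bb : ∀ x y : B, brk (iota x) (iota y) = jmap (A.tri x y, A.mul x y)
  brk_pb : ∀ r pa, pa ∈ IPSpan A A.g r → ∀ x : B, brk (jmap pa) (iota x) = iota (pa.1 x)
  brk_bp : ∀ r s x pa, x ∈ A.g r → pa ∈ IPSpan A A.g s →
    brk (iota x) (jmap pa) = -(sgn K r s • iota (pa.1 x))
  brk_pp : ∀ r s pa qb, pa ∈ IPSpan A A.g r → qb ∈ IPSpan A A.g s →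
    brk (jmap pa) (jmap qb) = jmap (pbrk A r s pa qb)
  sigma : L →ₗ[K] L
  sigma0 : ∀ v ∈ gL 0, sigma v = v
  sigma1 : ∀ v ∈ gL 1, sigma v = -v

variable [AddCommGroup L] [Module K L]

/-- The Killing form `α(u,v) = str(ad u ∘ ad v)` of the enveloping Lie
superalgebra, the supertrace being computed via the grading involution. -/
noncomputable def killing {A : BolSuper K B} (E : EnvSetup K B L A) (u v : L) : K :=
  LinearMap.trace K L (E.sigma ∘ₗ E.brk u ∘ₗ E.brk v)

/-- The Killing-Ricci form of `B`: the restriction of the Killing form of the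
standard enveloping Lie superalgebra to `B × B`. -/
noncomputable def kr {A : BolSuper K B} (E : EnvSetup K B L A) (x y : B) : K :=
  killing E (E.iota x) (E.iota y)

section Sign

variable (K : Type*) [Field K]

lemma parity_eq_zero_or_one : ∀ i : ZMod 2, i = 0 ∨ i = 1 := by decide

lemma sgn_zero_left (j : ZMod 2) : sgn K 0 j = 1 := by simp [sgn]

lemma sgn_zero_right (i : ZMod 2) : sgn K i 0 = 1 := by simp [sgn]

lemma sgn_one_one : sgn K 1 1 = -1 := by
  rw [sgn, show (1 * 1 : ZMod 2).val = 1 from rfl, pow_one]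

lemma sgn_comm (i j : ZMod 2) : sgn K i j = sgn K j i := by
  rw [sgn, sgn, mul_comm]

lemma sgn_add_left (i j k : ZMod 2) : sgn K (i + j) k = sgn K i k * sgn K j k := by
  have h : (1 + 1 : ZMod 2) = 0 := rfl
  rcases parity_eq_zero_or_one i with rfl | rfl <;>
  rcases parity_eq_zero_or_one j with rfl | rfl <;>
  rcases parity_eq_zero_or_one k with rfl | rfl <;>
  simp [sgn_zero_left, sgn_zero_right, sgn_one_one, h]

lemma sgn_add_right (i j k : ZMod 2) : sgn K i (j + k) = sgn K i j * sgn K i k := by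
  rw [sgn_comm, sgn_add_left, sgn_comm K j, sgn_comm K k]

end Sign

section Malcev

variable {K M : Type*} [Field K] [AddCommGroup M] [Module K M]

/-- A Malcev superalgebra structure on the graded space `g` with product `mul`. -/
structure IsMalcevSuper (g : ZMod 2 → Submodule K M) (mul : M →ₗ[K] M →ₗ[K] M) : Prop where
  mem : ∀ {i j : ZMod 2} {x y : M}, x ∈ g i → y ∈ g j → mul x y ∈ g (i + j)
  skew : ∀ {i j : ZMod 2} {x y : M}, x ∈ g i → y ∈ g j → mul x y = -(sgn K i j • mul y x)
  malcev : ∀ {i j k l : ZMod 2} {x y z t : M}, x ∈ g i → y ∈ g j → z ∈ g k → t ∈ g l →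
    mul (mul (mul x y) z) t - mul x (mul (mul y z) t)
      - sgn K j (k + l) • mul (mul x (mul z t)) y
      - sgn K l (j + k) • mul (mul (mul x t) y) z
      = sgn K j k • mul (mul x z) (mul y t)

/-- The degree-`r` endomorphism `P` is a superderivation of the trilinear operation `tri`. -/
def IsTriDer (g : ZMod 2 → Submodule K M) (tri : M →ₗ[K] M →ₗ[K] M →ₗ[K] M) (r : ZMod 2)
    (P : M →ₗ[K] M) : Prop :=
  (∀ {k u}, u ∈ g k → P u ∈ g (r + k)) ∧
  ∀ {k l m u v w}, u ∈ g k → v ∈ g l → w ∈ g m →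
    P (tri u v w) = tri (P u) v w + sgn K r k • tri u (P v) w
      + sgn K r (k + l) • tri u v (P w)

namespace IsTriDer

variable {g : ZMod 2 → Submodule K M} {tri : M →ₗ[K] M →ₗ[K] M →ₗ[K] M} {r s : ZMod 2}
  {P Q : M →ₗ[K] M}

lemma add (hP : IsTriDer g tri r P) (hQ : IsTriDer g tri r Q) : IsTriDer g tri r (P + Q) := by
  refine ⟨fun hu => add_mem (hP.1 hu) (hQ.1 hu), fun hu hv hw => ?_⟩
  simp only [LinearMap.add_apply, map_add, hP.2 hu hv hw, hQ.2 hu hv hw]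
  module

lemma smul (c : K) (hP : IsTriDer g tri r P) : IsTriDer g tri r (c • P) := by
  refine ⟨fun hu => Submodule.smul_mem _ c (hP.1 hu), fun hu hv hw => ?_⟩
  simp only [LinearMap.smul_apply, map_smul, hP.2 hu hv hw]
  module

lemma supercommutator (hP : IsTriDer g tri r P) (hQ : IsTriDer g tri s Q) :
    IsTriDer g tri (r + s) (P ∘ₗ Q - sgn K r s • (Q ∘ₗ P)) := by
  refine ⟨fun {k u} hu => ?_, fun {k l m u v w} hu hv hw => ?_⟩
  · have h₁ := hP.1 (hQ.1 hu)
    have h₂ := hQ.1 (hP.1 hu)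
    rw [← add_assoc] at h₁ h₂
    rw [add_comm s r] at h₂
    exact sub_mem h₁ (Submodule.smul_mem _ _ h₂)
  · simp only [LinearMap.sub_apply, LinearMap.smul_apply, LinearMap.comp_apply, map_sub, map_add,
      map_smul, hP.2 hu hv hw, hQ.2 hu hv hw, hP.2 (hQ.1 hu) hv hw, hP.2 hu (hQ.1 hv) hw,
      hP.2 hu hv (hQ.1 hw), hQ.2 (hP.1 hu) hv hw, hQ.2 hu (hP.1 hv) hw, hQ.2 hu hv (hP.1 hw),
      sgn_add_left, sgn_add_right]
    rcases parity_eq_zero_or_one r with rfl | rfl <;>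
    rcases parity_eq_zero_or_one s with rfl | rfl <;>
    simp only [sgn_zero_left, sgn_zero_right, sgn_one_one] <;>
    module

end IsTriDer

/-- The operation `3⁻¹ • (2 • [[x, y], z] + [x, [y, z]] - (-1)^(|x||y|) • [y, [x, z]])`, where `p`
is the projection to the odd part. -/
noncomputable def malcevTri (mul : M →ₗ[K] M →ₗ[K] M) (p : M →ₗ[K] M) :
    M →ₗ[K] M →ₗ[K] M →ₗ[K] M :=
  let C := (LinearMap.mul K (Module.End K M)).compl₁₂ mul mul
  (3 : K)⁻¹ • ((2 : K) • mul.compr₂ mul + C - (C - (2 : K) • C.compl₁₂ p p).flip)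

namespace IsMalcevSuper

variable {g : ZMod 2 → Submodule K M} {mul : M →ₗ[K] M →ₗ[K] M} {p : M →ₗ[K] M}
  {i j k l : ZMod 2} {a b c d : M}

lemma skew_right_mul (h : IsMalcevSuper g mul) (ha : a ∈ g i) (hb : b ∈ g j) (hc : c ∈ g k) :
    mul a (mul b c) = -(sgn K i (j + k) • mul (mul b c) a) :=
  h.skew ha (h.mem hb hc)

lemma skew_right_mul_mul (h : IsMalcevSuper g mul) (ha : a ∈ g i) (hb : b ∈ g j) (hc : c ∈ g k)
    (hd : d ∈ g l) :
    mul a (mul (mul b c) d) = -(sgn K i (j + k + l) • mul (mul (mul b c) d) a) :=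
  h.skew ha (h.mem (h.mem hb hc) hd)

lemma skew_mul_mul (h : IsMalcevSuper g mul) (ha : a ∈ g i) (hb : b ∈ g j) (hc : c ∈ g k)
    (hd : d ∈ g l) :
    mul (mul a b) (mul c d) = -(sgn K (i + j) (k + l) • mul (mul c d) (mul a b)) :=
  h.skew (h.mem ha hb) (h.mem hc hd)

lemma malcevTri_eq (hp₀ : ∀ x ∈ g 0, p x = 0) (hp₁ : ∀ x ∈ g 1, p x = x)
    (ha : a ∈ g i) (hb : b ∈ g j) :
    malcevTri mul p a b = (3 : K)⁻¹ • ((2 : K) • mul (mul a b)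
      + (mul a ∘ₗ mul b - sgn K i j • (mul b ∘ₗ mul a))) := by
  ext c
  rcases parity_eq_zero_or_one i with rfl | rfl <;>
  rcases parity_eq_zero_or_one j with rfl | rfl <;>
  simp only [malcevTri, hp₀ _, hp₁ _, ha, hb, LinearMap.smul_apply, LinearMap.add_apply,
    LinearMap.sub_apply, LinearMap.flip_apply, LinearMap.compl₁₂_apply, LinearMap.compr₂_apply,
    LinearMap.mul_apply', Module.End.mul_apply, LinearMap.comp_apply, sgn_zero_left,
    sgn_zero_right, sgn_one_one, map_zero, LinearMap.zero_apply] <;>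
  module

lemma malcevTri_apply (hp₀ : ∀ x ∈ g 0, p x = 0) (hp₁ : ∀ x ∈ g 1, p x = x)
    (ha : a ∈ g i) (hb : b ∈ g j) (c : M) :
    malcevTri mul p a b c = (3 : K)⁻¹ • ((2 : K) • mul (mul a b) c
      + (mul a (mul b c) - sgn K i j • mul b (mul a c))) := by
  rw [malcevTri_eq hp₀ hp₁ ha hb]
  rfl

lemma isTriDer_mul (h : IsMalcevSuper g mul) (hp₀ : ∀ x ∈ g 0, p x = 0)
    (hp₁ : ∀ x ∈ g 1, p x = x) (ha : a ∈ g i) : IsTriDer g (malcevTri mul p) i (mul a) := by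
  refine ⟨fun hb => h.mem ha hb, fun {j k l b c d} hb hc hd => ?_⟩
  rw [malcevTri_apply hp₀ hp₁ hb hc, malcevTri_apply hp₀ hp₁ (h.mem ha hb) hc,
    malcevTri_apply hp₀ hp₁ hb (h.mem ha hc), malcevTri_apply hp₀ hp₁ hb hc]
  linear_combination (norm := skip) (3 : K)⁻¹ • (-h.malcev ha hb hc hd
    - sgn K k l • h.malcev ha hb hd hc + sgn K j k • h.malcev ha hc hb hd
    + (sgn K j k * sgn K j l) • h.malcev ha hc hd hb)
  simp only [map_add, map_sub, map_neg, map_smul, LinearMap.neg_apply, LinearMap.smul_apply,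
    sgn_add_left, sgn_add_right, h.skew hc hb, h.skew hd hb, h.skew hd hc,
    h.skew_right_mul ha hb hd, h.skew_right_mul ha hc hd, h.skew_right_mul hb ha hc,
    h.skew_right_mul hb ha hd, h.skew_right_mul hb hc hd, h.skew_right_mul hc ha hd,
    h.skew_right_mul hc hb hd, h.skew_right_mul_mul ha hb hc hd, h.skew_right_mul_mul ha hb hd hc,
    h.skew_right_mul_mul ha hc hd hb, h.skew_right_mul_mul hb ha hc hd,
    h.skew_right_mul_mul hb ha hd hc, h.skew_right_mul_mul hc ha hb hd,
    h.skew_right_mul_mul hc ha hd hb, h.skew_mul_mul hb hc ha hd]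
  rcases parity_eq_zero_or_one i with rfl | rfl <;>
  rcases parity_eq_zero_or_one j with rfl | rfl <;>
  rcases parity_eq_zero_or_one k with rfl | rfl <;>
  rcases parity_eq_zero_or_one l with rfl | rfl <;>
  simp only [sgn_zero_left, sgn_zero_right, sgn_one_one] <;>
  module

lemma malcevTri_mul [CharZero K] (h : IsMalcevSuper g mul) (hp₀ : ∀ x ∈ g 0, p x = 0)
    (hp₁ : ∀ x ∈ g 1, p x = x) (ha : a ∈ g i) (hb : b ∈ g j) (hc : c ∈ g k) (hd : d ∈ g l) :
    malcevTri mul p a b (mul c d) = sgn K k (i + j) • mul c (malcevTri mul p a b d)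
      + mul (malcevTri mul p a b c) d + sgn K (i + j) (k + l) • malcevTri mul p c d (mul a b)
      + mul (mul a b) (mul c d) := by
  simp only [malcevTri_apply hp₀ hp₁ ha hb, malcevTri_apply hp₀ hp₁ hc hd]
  linear_combination (norm := skip) (3 : K)⁻¹ • (sgn K k l • h.malcev ha hb hd hc
    + (sgn K j k * sgn K j l) • h.malcev ha hc hd hb
    + (sgn K j l * sgn K k l) • h.malcev ha hd hb hc)
  simp only [map_add, map_sub, map_neg, map_smul, LinearMap.add_apply, LinearMap.sub_apply,
    LinearMap.neg_apply, LinearMap.smul_apply, sgn_add_left, sgn_add_right, h.skew hc hb,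
    h.skew hd hb, h.skew hd hc, h.skew_right_mul ha hb hc, h.skew_right_mul ha hb hd,
    h.skew_right_mul ha hc hd, h.skew_right_mul hb ha hc, h.skew_right_mul hb ha hd,
    h.skew_right_mul hb hc hd, h.skew_right_mul hc ha hb, h.skew_right_mul hd ha hb,
    h.skew_right_mul_mul ha hb hd hc, h.skew_right_mul_mul ha hc hd hb,
    h.skew_right_mul_mul hb hc hd ha, h.skew_right_mul_mul hc ha hb hd,
    h.skew_right_mul_mul hc ha hd hb, h.skew_right_mul_mul hc hb hd ha,
    h.skew_right_mul_mul hd ha hb hc, h.skew_mul_mul hc hd ha hb]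
  rcases parity_eq_zero_or_one i with rfl | rfl <;>
  rcases parity_eq_zero_or_one j with rfl | rfl <;>
  rcases parity_eq_zero_or_one k with rfl | rfl <;>
  rcases parity_eq_zero_or_one l with rfl | rfl <;>
  simp only [sgn_zero_left, sgn_zero_right, sgn_one_one] <;>
  module

lemma malcevTri_eq_bracket (h : IsMalcevSuper g mul) (hp₀ : ∀ x ∈ g 0, p x = 0)
    (hp₁ : ∀ x ∈ g 1, p x = x) (ha : a ∈ g i) (hb : b ∈ g j) (hc : c ∈ g k) :
    malcevTri mul p a b c = (3 : K)⁻¹ • ((2 : K) • mul (mul a b) c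
      - sgn K i (j + k) • mul (mul b c) a - sgn K k (i + j) • mul (mul c a) b) := by
  rw [malcevTri_apply hp₀ hp₁ ha hb]
  simp only [h.skew hc ha, h.skew_right_mul ha hb hc, h.skew_right_mul hb ha hc, map_neg, map_smul,
    LinearMap.neg_apply, LinearMap.smul_apply, sgn_add_right]
  rcases parity_eq_zero_or_one i with rfl | rfl <;>
  rcases parity_eq_zero_or_one j with rfl | rfl <;>
  rcases parity_eq_zero_or_one k with rfl | rfl <;>
  simp only [sgn_zero_left, sgn_zero_right, sgn_one_one] <;>
  module

lemma malcevTri_skew (h : IsMalcevSuper g mul) (hp₀ : ∀ x ∈ g 0, p x = 0)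
    (hp₁ : ∀ x ∈ g 1, p x = x) (ha : a ∈ g i) (hb : b ∈ g j) (c : M) :
    malcevTri mul p a b c = -(sgn K i j • malcevTri mul p b a c) := by
  rw [malcevTri_apply hp₀ hp₁ ha hb, malcevTri_apply hp₀ hp₁ hb ha, h.skew hb ha]
  simp only [map_neg, map_smul, LinearMap.neg_apply, LinearMap.smul_apply]
  rcases parity_eq_zero_or_one i with rfl | rfl <;>
  rcases parity_eq_zero_or_one j with rfl | rfl <;>
  simp only [sgn_zero_left, sgn_zero_right, sgn_one_one] <;>
  module

lemma malcevTri_cyclic (h : IsMalcevSuper g mul) (hp₀ : ∀ x ∈ g 0, p x = 0)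
    (hp₁ : ∀ x ∈ g 1, p x = x) (ha : a ∈ g i) (hb : b ∈ g j) (hc : c ∈ g k) :
    malcevTri mul p a b c + sgn K i (j + k) • malcevTri mul p b c a
      + sgn K k (i + j) • malcevTri mul p c a b = 0 := by
  rw [h.malcevTri_eq_bracket hp₀ hp₁ ha hb hc, h.malcevTri_eq_bracket hp₀ hp₁ hb hc ha,
    h.malcevTri_eq_bracket hp₀ hp₁ hc ha hb]
  simp only [sgn_add_right]
  rcases parity_eq_zero_or_one i with rfl | rfl <;>
  rcases parity_eq_zero_or_one j with rfl | rfl <;>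
  rcases parity_eq_zero_or_one k with rfl | rfl <;>
  simp only [sgn_zero_left, sgn_zero_right, sgn_one_one] <;>
  module

lemma isTriDer_malcevTri (h : IsMalcevSuper g mul) (hp₀ : ∀ x ∈ g 0, p x = 0)
    (hp₁ : ∀ x ∈ g 1, p x = x) (ha : a ∈ g i) (hb : b ∈ g j) :
    IsTriDer g (malcevTri mul p) (i + j) (malcevTri mul p a b) := by
  rw [malcevTri_eq hp₀ hp₁ ha hb]
  exact (((h.isTriDer_mul hp₀ hp₁ (h.mem ha hb)).smul 2).add
    ((h.isTriDer_mul hp₀ hp₁ ha).supercommutator (h.isTriDer_mul hp₀ hp₁ hb))).smul _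

end IsMalcevSuper

end Malcev

/-- a Malcev superalgebra `(M,[·,·])` with the trilinear
operation `{x,y,z} = (1/3)(2[[x,y],z] - (-1)^{|x|(|y|+|z|)}[[y,z],x]
- (-1)^{|z|(|x|+|y|)}[[z,x],y])` is a Bol superalgebra. -/
theorem stmt15 {K M : Type*} [Field K] [CharZero K] [AddCommGroup M] [Module K M]
    (g : ZMod 2 → Submodule K M) (internal : DirectSum.IsInternal g)
    (mul : M →ₗ[K] M →ₗ[K] M)
    (hmem : ∀ (i j : ZMod 2) (x y : M), x ∈ g i → y ∈ g j → mul x y ∈ g (i + j))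
    (hskew : ∀ (i j : ZMod 2) (x y : M), x ∈ g i → y ∈ g j →
      mul x y = -(sgn K i j • mul y x))
    (hmalcev : ∀ (i j k l : ZMod 2) (x y z t : M),
      x ∈ g i → y ∈ g j → z ∈ g k → t ∈ g l →
      mul (mul (mul x y) z) t - mul x (mul (mul y z) t)
        - sgn K j (k + l) • mul (mul x (mul z t)) y
        - sgn K l (j + k) • mul (mul (mul x t) y) z
        = sgn K j k • mul (mul x z) (mul y t)) :
    ∃ A : BolSuper K M, A.g = g ∧ A.mul = mul ∧
      ∀ (i j k : ZMod 2) (x y z : M), x ∈ g i → y ∈ g j → z ∈ g k →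
        A.tri x y z = (3 : K)⁻¹ • ((2 : K) • mul (mul x y) z
          - sgn K i (j + k) • mul (mul y z) x
          - sgn K k (i + j) • mul (mul z x) y) := by
  have h : IsMalcevSuper g mul :=
    ⟨fun hx hy => hmem _ _ _ _ hx hy, fun hx hy => hskew _ _ _ _ hx hy,
      fun hx hy hz ht => hmalcev _ _ _ _ _ _ _ _ hx hy hz ht⟩
  have hc : IsCompl (g 1) (g 0) := internal.isCompl one_ne_zero (by ext i; revert i; decide)
  have hp₀ : ∀ x ∈ g 0, (g 1).projection (g 0) hc x = 0 := fun x hx =>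
    (Submodule.projection_apply_eq_zero_iff hc).2 hx
  have hp₁ : ∀ x ∈ g 1, (g 1).projection (g 0) hc x = x := fun x hx =>
    Submodule.projection_apply_left hc ⟨x, hx⟩
  refine ⟨{ g := g, internal := internal, mul := mul
            tri := malcevTri mul ((g 1).projection (g 0) hc)
            mul_mem := hmem
            tri_mem := fun i j k x y z hx hy hz => (h.isTriDer_malcevTri hp₀ hp₁ hx hy).1 hz
            bs1 := hskew
            bs2 := fun i j k x y z hx hy _ => h.malcevTri_skew hp₀ hp₁ hx hy z
            bs3 := fun i j k x y z hx hy hz => h.malcevTri_cyclic hp₀ hp₁ hx hy hz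
            bs4 := fun i j k l m x y u v w hx hy hu hv hw => by
              rw [sgn_comm K k]
              exact (h.isTriDer_malcevTri hp₀ hp₁ hx hy).2 hu hv hw
            bs5 := fun i j k l x y u v hx hy hu hv => h.malcevTri_mul hp₀ hp₁ hx hy hu hv },
    rfl, rfl, fun i j k x y z hx hy hz => h.malcevTri_eq_bracket hp₀ hp₁ hx hy hz⟩
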